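/- Let λ~: C~ → C~′ be a morphism of S-complexes over a commutative ring R with irreducible component λ: (C, d) → (C′, d′) and reducible component ρ: (𝖱, r) → (𝖱′, r′). Suppose λ is chain homotopic to an isomorphism, i.e. there exists a degree-1 map K: C → C′ such that λ − (d′K + Kd) is bijective, and suppose likewise that ρ is chain homotopic to an isomorphism, i.e. there exists a degree-1 map J: 𝖱 → 𝖱′ such that ρ − (r′J + Jr) is bijective. Then λ~ is S-chain homotopic to an isomorphism of S-complexes, i.e. to a morphism λ~° which is bijective and whose inverse is also a morphism of S-complexes. -/

import Mathlib

set_option maxHeartbeats 1000000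

open Function

universe u

/-- A `ℤ`-graded `R`-module, presented as an `R`-module together with a family of submodules
(the homogeneous pieces). -/
structure GradedMod (R : Type u) [CommRing R] : Type (u + 1) where
  carrier : Type u
  [isAddCommGroup : AddCommGroup carrier]
  [isModule : Module R carrier]
  grading : ℤ → Submodule R carrier

attribute [instance] GradedMod.isAddCommGroup GradedMod.isModule

namespace GradedMod

variable {R : Type u} [CommRing R]

/-- `f` is homogeneous of degree `k` with respect to the gradings. -/
def IsDeg (M N : GradedMod R) (k : ℤ) (f : M.carrier →ₗ[R] N.carrier) : Prop :=
  ∀ i : ℤ, (M.grading i).map f ≤ N.grading (i + k)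

/-- The grading is an internal direct sum decomposition with finitely generated free pieces,
only finitely many of which are nonzero; i.e., the graded module is finitely generated and
free as a graded `R`-module. -/
def IsFGFree (M : GradedMod R) : Prop :=
  DirectSum.IsInternal M.grading ∧ (∀ i : ℤ, Module.Free R ↥(M.grading i)) ∧
    (∀ i : ℤ, Module.Finite R ↥(M.grading i)) ∧ {i : ℤ | M.grading i ≠ ⊥}.Finite

/-- `e` is the sign operator `ε`, acting on the degree `i` homogeneous part by `(-1)^i`. -/
def IsSign (M : GradedMod R) (e : M.carrier →ₗ[R] M.carrier) : Prop :=
  ∀ i : ℤ, ∀ x ∈ M.grading i, e x = if Even i then x else -x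

/-- The shift `M[n]`, with `M[n]_j = M_{n+j}`. -/
def shift (M : GradedMod R) (n : ℤ) : GradedMod R where
  carrier := M.carrier
  grading j := M.grading (n + j)

/-- Direct sum (product) of graded modules. -/
def prodGM (M N : GradedMod R) : GradedMod R where
  carrier := M.carrier × N.carrier
  grading j := (M.grading j).prod (N.grading j)

/-- Tensor product of graded modules, `(M ⊗ N)_k = ⊕_{i+j=k} M_i ⊗ N_j`. -/
noncomputable def tensorGM (M N : GradedMod R) : GradedMod R where
  carrier := TensorProduct R M.carrier N.carrier
  grading k := ⨆ i : ℤ, Submodule.map₂ (TensorProduct.mk R M.carrier N.carrier)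
      (M.grading i) (N.grading (k - i))

/-- Dual of a graded module: a functional has degree `-i` if it kills all `M_j`, `j ≠ i`. -/
def dualGM (M : GradedMod R) : GradedMod R where
  carrier := Module.Dual R M.carrier
  grading j := ⨅ (i : ℤ) (_ : i ≠ -j), (M.grading i).dualAnnihilator

end GradedMod

variable {R : Type u} [CommRing R]

/-- Iterated composition of a linear endomorphism. -/
def lpow {M : Type u} [AddCommGroup M] [Module R M] (f : M →ₗ[R] M) : ℕ → (M →ₗ[R] M)
  | 0 => LinearMap.id
  | n + 1 => f ∘ₗ lpow f n

section ProdHelpers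

variable {A B C D E : Type u} [AddCommGroup A] [Module R A] [AddCommGroup B] [Module R B]
  [AddCommGroup C] [Module R C] [AddCommGroup D] [Module R D] [AddCommGroup E] [Module R E]

def pj₁ : (A × B × C) →ₗ[R] A := LinearMap.fst R A (B × C)
def pj₂ : (A × B × C) →ₗ[R] B := (LinearMap.fst R B C) ∘ₗ (LinearMap.snd R A (B × C))
def pj₃ : (A × B × C) →ₗ[R] C := (LinearMap.snd R B C) ∘ₗ (LinearMap.snd R A (B × C))

def tri (f : D →ₗ[R] A) (g : D →ₗ[R] B) (h : D →ₗ[R] C) : D →ₗ[R] A × B × C :=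
  f.prod (g.prod h)

def qj₁ : (A × B × C × D) →ₗ[R] A := LinearMap.fst R A (B × C × D)
def qj₂ : (A × B × C × D) →ₗ[R] B := (LinearMap.fst R B (C × D)) ∘ₗ (LinearMap.snd R A (B × C × D))
def qj₃ : (A × B × C × D) →ₗ[R] C :=
  (LinearMap.fst R C D) ∘ₗ (LinearMap.snd R B (C × D)) ∘ₗ (LinearMap.snd R A (B × C × D))
def qj₄ : (A × B × C × D) →ₗ[R] D :=
  (LinearMap.snd R C D) ∘ₗ (LinearMap.snd R B (C × D)) ∘ₗ (LinearMap.snd R A (B × C × D))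

def quad (f : E →ₗ[R] A) (g : E →ₗ[R] B) (h : E →ₗ[R] C) (l : E →ₗ[R] D) :
    E →ₗ[R] A × B × C × D := f.prod (g.prod (h.prod l))

end ProdHelpers

/-- The data of an `S`-complex over `R`: graded modules `C` (irreducible summand) and
`𝖱` (reducible summand), together with the component maps of the differential
`d~ = [[d, 0, 0], [v, −d, δ₂], [δ₁, 0, r]]` with respect to `C~ = C ⊕ C[-1] ⊕ 𝖱`. -/
structure SCData (R : Type u) [CommRing R] : Type (u + 1) where
  Irr : GradedMod R
  Red : GradedMod R
  d : Irr.carrier →ₗ[R] Irr.carrier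
  v : Irr.carrier →ₗ[R] Irr.carrier
  δ₁ : Irr.carrier →ₗ[R] Red.carrier
  δ₂ : Red.carrier →ₗ[R] Irr.carrier
  r : Red.carrier →ₗ[R] Red.carrier

namespace SCData

/-- The five relations equivalent to `d~ ∘ d~ = 0`. -/
def Relations (S : SCData R) : Prop :=
  S.d ∘ₗ S.d = 0 ∧
  S.δ₁ ∘ₗ S.d + S.r ∘ₗ S.δ₁ = 0 ∧
  S.d ∘ₗ S.δ₂ - S.δ₂ ∘ₗ S.r = 0 ∧
  S.d ∘ₗ S.v - S.v ∘ₗ S.d - S.δ₂ ∘ₗ S.δ₁ = 0 ∧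
  S.r ∘ₗ S.r = 0

/-- The degree conditions making `d~` a degree `−1` map on `C~ = C ⊕ C[-1] ⊕ 𝖱`. -/
def Degrees (S : SCData R) : Prop :=
  S.Irr.IsDeg S.Irr (-1) S.d ∧ S.Irr.IsDeg S.Irr (-2) S.v ∧
  S.Irr.IsDeg S.Red (-1) S.δ₁ ∧ S.Red.IsDeg S.Irr (-2) S.δ₂ ∧
  S.Red.IsDeg S.Red (-1) S.r

/-- `S` is an `S`-complex. -/
def IsSComplex (S : SCData R) : Prop :=
  S.Irr.IsFGFree ∧ S.Red.IsFGFree ∧ S.Degrees ∧ S.Relations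

/-- `S` is `r`-perfect: the reducible summand is concentrated in even degrees
(which forces `r = 0` and `δ₁ ∘ v^i ∘ δ₂ = 0` for all `i ≥ 0`). -/
def RPerfect (S : SCData R) : Prop :=
  (∀ j : ℤ, Odd j → S.Red.grading j = ⊥) ∧ S.r = 0 ∧
    ∀ i : ℕ, S.δ₁ ∘ₗ lpow S.v i ∘ₗ S.δ₂ = 0

/-- The total graded module `C~ = C ⊕ C[-1] ⊕ 𝖱`. -/
def Tot (S : SCData R) : GradedMod R where
  carrier := S.Irr.carrier × S.Irr.carrier × S.Red.carrier
  grading j := (S.Irr.grading j).prod ((S.Irr.grading (j - 1)).prod (S.Red.grading j))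

/-- The total differential `d~(c, c', ρ) = (d c, v c − d c' + δ₂ ρ, δ₁ c + r ρ)`. -/
def totalDiff (S : SCData R) : S.Tot.carrier →ₗ[R] S.Tot.carrier :=
  tri (S.d ∘ₗ pj₁) (S.v ∘ₗ pj₁ - S.d ∘ₗ pj₂ + S.δ₂ ∘ₗ pj₃) (S.δ₁ ∘ₗ pj₁ + S.r ∘ₗ pj₃)

/-- The map `χ(c, c', ρ) = (0, c, 0)`. -/
def totalChi (S : SCData R) : S.Tot.carrier →ₗ[R] S.Tot.carrier :=
  tri 0 pj₁ 0

/-- The suspension `ΣC~`: `C_Σ = C[-2] ⊕ 𝖱[-1]`, `𝖱_Σ = 𝖱`, with the differential of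
Definition 2.9 of the paper. -/
def susp (S : SCData R) : SCData R where
  Irr := { carrier := S.Irr.carrier × S.Red.carrier
           grading := fun j => (S.Irr.grading (j - 2)).prod (S.Red.grading (j - 1)) }
  Red := S.Red
  d := LinearMap.prod
      (S.d ∘ₗ LinearMap.fst R S.Irr.carrier S.Red.carrier -
        S.δ₂ ∘ₗ LinearMap.snd R S.Irr.carrier S.Red.carrier)
      (-(S.r ∘ₗ LinearMap.snd R S.Irr.carrier S.Red.carrier))
  v := LinearMap.prod (S.v ∘ₗ LinearMap.fst R S.Irr.carrier S.Red.carrier)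
      (S.δ₁ ∘ₗ LinearMap.fst R S.Irr.carrier S.Red.carrier)
  δ₁ := LinearMap.snd R S.Irr.carrier S.Red.carrier
  δ₂ := LinearMap.prod (S.v ∘ₗ S.δ₂) (S.δ₁ ∘ₗ S.δ₂)
  r := S.r

/-- The negative suspension `Σ⁻¹C~`: `C_{Σ⁻¹} = C[2] ⊕ 𝖱[2]`, `𝖱_{Σ⁻¹} = 𝖱`. -/
def negSusp (S : SCData R) : SCData R where
  Irr := { carrier := S.Irr.carrier × S.Red.carrier
           grading := fun j => (S.Irr.grading (j + 2)).prod (S.Red.grading (j + 2)) }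
  Red := S.Red
  d := LinearMap.prod (S.d ∘ₗ LinearMap.fst R S.Irr.carrier S.Red.carrier)
      (S.δ₁ ∘ₗ LinearMap.fst R S.Irr.carrier S.Red.carrier +
        S.r ∘ₗ LinearMap.snd R S.Irr.carrier S.Red.carrier)
  v := LinearMap.prod (S.v ∘ₗ LinearMap.fst R S.Irr.carrier S.Red.carrier +
        S.δ₂ ∘ₗ LinearMap.snd R S.Irr.carrier S.Red.carrier) 0
  δ₁ := S.δ₁ ∘ₗ S.v ∘ₗ LinearMap.fst R S.Irr.carrier S.Red.carrier +
        S.δ₁ ∘ₗ S.δ₂ ∘ₗ LinearMap.snd R S.Irr.carrier S.Red.carrier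
  δ₂ := LinearMap.prod 0 LinearMap.id
  r := S.r

/-- `Σ^n`, the `n`-fold (negative) suspension. -/
def suspPow (S : SCData R) : ℤ → SCData R
  | Int.ofNat n => (fun X : SCData R => X.susp)^[n] S
  | Int.negSucc n => (fun X : SCData R => X.negSusp)^[n + 1] S

/-- The shifted `S`-complex `C~[n]`: gradings shifted, same differential and `χ`-map. -/
def shiftSC (S : SCData R) (n : ℤ) : SCData R where
  Irr := S.Irr.shift n
  Red := S.Red.shift n
  d := S.d
  v := S.v
  δ₁ := S.δ₁
  δ₂ := S.δ₂
  r := S.r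

end SCData

/-- A map of `S`-complexes in block form `[[λ, 0, 0], [μ, λ, Δ₂], [Δ₁, 0, ρ]]`
(equivalently, a `χ`-equivariant map `C~ → C~'`); used both for morphisms and
(with appropriate signs in the total interpretation) for homotopies. -/
structure SMap {R : Type u} [CommRing R] (S T : SCData R) : Type u where
  lam : S.Irr.carrier →ₗ[R] T.Irr.carrier
  mu : S.Irr.carrier →ₗ[R] T.Irr.carrier
  del1 : S.Irr.carrier →ₗ[R] T.Red.carrier
  del2 : S.Red.carrier →ₗ[R] T.Irr.carrier
  rho : S.Red.carrier →ₗ[R] T.Red.carrier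

namespace SMap

variable {S T U : SCData R}

/-- The component relations equivalent to `d~' λ~ = λ~ d~`. -/
def IsMor (f : SMap S T) : Prop :=
  T.d ∘ₗ f.lam - f.lam ∘ₗ S.d = 0 ∧
  f.del1 ∘ₗ S.d + f.rho ∘ₗ S.δ₁ - T.δ₁ ∘ₗ f.lam - T.r ∘ₗ f.del1 = 0 ∧
  T.d ∘ₗ f.del2 - T.δ₂ ∘ₗ f.rho + f.lam ∘ₗ S.δ₂ + f.del2 ∘ₗ S.r = 0 ∧
  f.mu ∘ₗ S.d + T.d ∘ₗ f.mu + f.lam ∘ₗ S.v - T.v ∘ₗ f.lam + f.del2 ∘ₗ S.δ₁ - T.δ₂ ∘ₗ f.del1 = 0 ∧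
  f.rho ∘ₗ S.r - T.r ∘ₗ f.rho = 0

/-- The components have the degrees of a degree `k` map of `S`-complexes. -/
def DegreesAt (f : SMap S T) (k : ℤ) : Prop :=
  S.Irr.IsDeg T.Irr k f.lam ∧ S.Irr.IsDeg T.Irr (k - 1) f.mu ∧
  S.Irr.IsDeg T.Red k f.del1 ∧ S.Red.IsDeg T.Irr (k - 1) f.del2 ∧
  S.Red.IsDeg T.Red k f.rho

/-- Composition of morphisms of `S`-complexes, componentwise. -/
def comp (g : SMap T U) (f : SMap S T) : SMap S U where
  lam := g.lam ∘ₗ f.lam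
  mu := g.lam ∘ₗ f.mu + g.mu ∘ₗ f.lam + g.del2 ∘ₗ f.del1
  del1 := g.del1 ∘ₗ f.lam + g.rho ∘ₗ f.del1
  del2 := g.lam ∘ₗ f.del2 + g.del2 ∘ₗ f.rho
  rho := g.rho ∘ₗ f.rho

/-- `K` is an `S`-chain homotopy from `f` to `g`, i.e. `d~' K~ + K~ d~ = λ~ - λ~'` where
`K~ = [[K, 0, 0], [L, -K, M₂], [M₁, 0, J]]`, in component form. -/
def IsHtpyFrom (K f g : SMap S T) : Prop :=
  T.d ∘ₗ K.lam + K.lam ∘ₗ S.d - f.lam + g.lam = 0 ∧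
  T.δ₁ ∘ₗ K.lam + T.r ∘ₗ K.del1 + K.del1 ∘ₗ S.d + K.rho ∘ₗ S.δ₁ - f.del1 + g.del1 = 0 ∧
  -(T.d ∘ₗ K.del2) + T.δ₂ ∘ₗ K.rho - K.lam ∘ₗ S.δ₂ + K.del2 ∘ₗ S.r - f.del2 + g.del2 = 0 ∧
  T.v ∘ₗ K.lam - T.d ∘ₗ K.mu + T.δ₂ ∘ₗ K.del1 + K.mu ∘ₗ S.d - K.lam ∘ₗ S.v + K.del2 ∘ₗ S.δ₁
    - f.mu + g.mu = 0 ∧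
  T.r ∘ₗ K.rho + K.rho ∘ₗ S.r - f.rho + g.rho = 0

end SMap

/-- The identity morphism. -/
def idMap (S : SCData R) : SMap S S where
  lam := LinearMap.id
  mu := 0
  del1 := 0
  del2 := 0
  rho := LinearMap.id

/-- The total map `C~ → C~'` of a morphism in block form. -/
def morTotal {S T : SCData R} (f : SMap S T) : S.Tot.carrier →ₗ[R] T.Tot.carrier :=
  tri (f.lam ∘ₗ pj₁) (f.mu ∘ₗ pj₁ + f.lam ∘ₗ pj₂ + f.del2 ∘ₗ pj₃) (f.del1 ∘ₗ pj₁ + f.rho ∘ₗ pj₃)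

/-- The total map `C~ → C~'` of a homotopy in block form. -/
def htpTotal {S T : SCData R} (K : SMap S T) : S.Tot.carrier →ₗ[R] T.Tot.carrier :=
  tri (K.lam ∘ₗ pj₁) (K.mu ∘ₗ pj₁ - K.lam ∘ₗ pj₂ + K.del2 ∘ₗ pj₃) (K.del1 ∘ₗ pj₁ + K.rho ∘ₗ pj₃)

/-- `S`-chain homotopy equivalence of `S`-complexes. -/
def SHomotopyEquiv (S T : SCData R) : Prop :=
  ∃ (f : SMap S T) (g : SMap T S) (H₁ : SMap S S) (H₂ : SMap T T),
    f.IsMor ∧ f.DegreesAt 0 ∧ g.IsMor ∧ g.DegreesAt 0 ∧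
    H₁.DegreesAt 1 ∧ SMap.IsHtpyFrom H₁ (g.comp f) (idMap S) ∧
    H₂.DegreesAt 1 ∧ SMap.IsHtpyFrom H₂ (f.comp g) (idMap T)

/-- Isomorphism of `S`-complexes: a (degree `0`) morphism with a two-sided inverse morphism. -/
def SIso (S T : SCData R) : Prop :=
  ∃ (f : SMap S T) (g : SMap T S), f.IsMor ∧ f.DegreesAt 0 ∧ g.IsMor ∧ g.DegreesAt 0 ∧
    g.comp f = idMap S ∧ f.comp g = idMap T

/-- The suspension `Σλ~` of a morphism `λ~`, in block form. -/
def suspMap {S T : SCData R} (f : SMap S T) : SMap S.susp T.susp where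
  lam := LinearMap.prod
      (f.lam ∘ₗ LinearMap.fst R S.Irr.carrier S.Red.carrier +
        f.del2 ∘ₗ LinearMap.snd R S.Irr.carrier S.Red.carrier)
      (f.rho ∘ₗ LinearMap.snd R S.Irr.carrier S.Red.carrier)
  mu := LinearMap.prod (f.mu ∘ₗ LinearMap.fst R S.Irr.carrier S.Red.carrier)
      (f.del1 ∘ₗ LinearMap.fst R S.Irr.carrier S.Red.carrier)
  del1 := 0
  del2 := LinearMap.prod (f.mu ∘ₗ S.δ₂ + T.v ∘ₗ f.del2) (f.del1 ∘ₗ S.δ₂ + T.δ₁ ∘ₗ f.del2)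
  rho := f.rho

/-- The suspension `ΣK~` of a homotopy `K~`, in block form. -/
def suspHtpy {S T : SCData R} (K : SMap S T) : SMap S.susp T.susp where
  lam := LinearMap.prod
      (K.lam ∘ₗ LinearMap.fst R S.Irr.carrier S.Red.carrier -
        K.del2 ∘ₗ LinearMap.snd R S.Irr.carrier S.Red.carrier)
      (-(K.rho ∘ₗ LinearMap.snd R S.Irr.carrier S.Red.carrier))
  mu := LinearMap.prod (K.mu ∘ₗ LinearMap.fst R S.Irr.carrier S.Red.carrier)
      (K.del1 ∘ₗ LinearMap.fst R S.Irr.carrier S.Red.carrier)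
  del1 := 0
  del2 := LinearMap.prod (T.v ∘ₗ K.del2 + K.mu ∘ₗ S.δ₂) (T.δ₁ ∘ₗ K.del2 + K.del1 ∘ₗ S.δ₂)
  rho := K.rho

/-- The sequence `τ_0 = ρ`, `τ_{i+1} = δ₁'v'^iΔ₂ + Δ₁v^iδ₂ + Σ_{j<i} δ₁'v'^j μ v^{i−1−j} δ₂`
attached to an (even degree) morphism between `r`-perfect `S`-complexes. -/
def tauSMap {S T : SCData R} (f : SMap S T) : ℕ → (S.Red.carrier →ₗ[R] T.Red.carrier)
  | 0 => f.rho
  | i + 1 =>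
      T.δ₁ ∘ₗ lpow T.v i ∘ₗ f.del2 + f.del1 ∘ₗ lpow S.v i ∘ₗ S.δ₂ +
        ∑ j ∈ Finset.range i, T.δ₁ ∘ₗ lpow T.v j ∘ₗ f.mu ∘ₗ lpow S.v (i - 1 - j) ∘ₗ S.δ₂

/-- Height `n` (for `n ≥ 0`): `τ_j = 0` for `0 ≤ j < n`. -/
def SMap.HasHeight {S T : SCData R} (f : SMap S T) (n : ℕ) : Prop :=
  ∀ j : ℕ, j < n → tauSMap f j = 0

/-- Strong height `n`: height `n` and `τ_n` an isomorphism. -/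
def SMap.StrongHeight {S T : SCData R} (f : SMap S T) (n : ℕ) : Prop :=
  f.HasHeight n ∧ Function.Bijective ⇑(tauSMap f n)

/-- The explicit model of the `n`-fold suspension `Σ^n C~` of an `r`-perfect `S`-complex:
`C_{Σ^n} = C[-2n] ⊕ ⊕_{i=0}^{n-1} 𝖱[-2i-1]` (the `m`-th factor of `Fin n → 𝖱` being
`𝖱[-2(n-1-m)-1]`), `𝖱_{Σ^n} = 𝖱`, with the components of the differential as in
Subsection 2.4 of the paper. -/
def SCData.suspN (S : SCData R) (n : ℕ) : SCData R where
  Irr := { carrier := S.Irr.carrier × (Fin n → S.Red.carrier)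
           grading := fun j => (S.Irr.grading (j - 2 * (n : ℤ))).prod
             (Submodule.pi Set.univ fun m : Fin n =>
               S.Red.grading (j - 2 * (((n - 1 - (m : ℕ) : ℕ)) : ℤ) - 1)) }
  Red := S.Red
  d := LinearMap.prod
      (S.d ∘ₗ LinearMap.fst R S.Irr.carrier (Fin n → S.Red.carrier) -
        ∑ m : Fin n, lpow S.v (m : ℕ) ∘ₗ S.δ₂ ∘ₗ LinearMap.proj m ∘ₗ
          LinearMap.snd R S.Irr.carrier (Fin n → S.Red.carrier)) 0
  v := LinearMap.prod (S.v ∘ₗ LinearMap.fst R S.Irr.carrier (Fin n → S.Red.carrier))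
      (LinearMap.pi fun m : Fin n =>
        if (m : ℕ) = 0 then S.δ₁ ∘ₗ LinearMap.fst R S.Irr.carrier (Fin n → S.Red.carrier)
        else LinearMap.proj (⟨(m : ℕ) - 1, lt_of_le_of_lt (Nat.sub_le _ _) m.isLt⟩ : Fin n) ∘ₗ
          LinearMap.snd R S.Irr.carrier (Fin n → S.Red.carrier))
  δ₁ := if h : 0 < n then
      LinearMap.proj (⟨n - 1, Nat.sub_lt h Nat.one_pos⟩ : Fin n) ∘ₗ
        LinearMap.snd R S.Irr.carrier (Fin n → S.Red.carrier)
    else 0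
  δ₂ := LinearMap.prod (lpow S.v n ∘ₗ S.δ₂) 0
  r := 0

/-- The natural morphism `ι~_n : C~ → Σ^n C~`, with `λ`-component `c ↦ (c, 0, …, 0)` and
`Δ₂`-component `θ ↦ (0, θ, 0, …, 0)`. -/
def iotaN (S : SCData R) (n : ℕ) : SMap S (S.suspN n) where
  lam := LinearMap.prod LinearMap.id 0
  mu := 0
  del1 := 0
  del2 := LinearMap.prod 0 (LinearMap.pi fun m : Fin n => if (m : ℕ) = 0 then LinearMap.id else 0)
  rho := 0

/-- The data of a generalized height morphism between `r`-perfect `S`-complexes: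
the four maps `λ, μ, Δ₁, Δ₂` and the sequence `τ_i` for `i ∈ ℤ`. -/
structure HMor {R : Type u} [CommRing R] (S T : SCData R) : Type u where
  lam : S.Irr.carrier →ₗ[R] T.Irr.carrier
  mu : S.Irr.carrier →ₗ[R] T.Irr.carrier
  del1 : S.Irr.carrier →ₗ[R] T.Red.carrier
  del2 : S.Red.carrier →ₗ[R] T.Irr.carrier
  tau : ℤ → (S.Red.carrier →ₗ[R] T.Red.carrier)

/-- `f` is a height `n` morphism of (even) degree `k` between `r`-perfect `S`-complexes. -/
def HMor.IsHeightMor {S T : SCData R} (f : HMor S T) (n : ℤ) (k : ℤ) : Prop :=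
  Even k ∧
  S.Irr.IsDeg T.Irr k f.lam ∧ S.Irr.IsDeg T.Irr (k - 1) f.mu ∧
  S.Irr.IsDeg T.Red k f.del1 ∧ S.Red.IsDeg T.Irr (k - 1) f.del2 ∧
  (∀ i : ℤ, S.Red.IsDeg T.Red (k - 2 * i) (f.tau i)) ∧
  (∀ i : ℤ, i < n → f.tau i = 0) ∧
  (∀ i : ℕ, f.tau ((i : ℤ) + 1) =
      T.δ₁ ∘ₗ lpow T.v i ∘ₗ f.del2 + f.del1 ∘ₗ lpow S.v i ∘ₗ S.δ₂ +
        ∑ j ∈ Finset.range i, T.δ₁ ∘ₗ lpow T.v j ∘ₗ f.mu ∘ₗ lpow S.v (i - 1 - j) ∘ₗ S.δ₂) ∧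
  (T.d ∘ₗ f.lam - f.lam ∘ₗ S.d -
      ∑ᶠ i : ℕ, ∑ j ∈ Finset.range (i + 1),
        lpow T.v j ∘ₗ T.δ₂ ∘ₗ f.tau (-((i : ℤ) + 1)) ∘ₗ S.δ₁ ∘ₗ lpow S.v (i - j) = 0) ∧
  (-(T.δ₁ ∘ₗ f.lam) + f.del1 ∘ₗ S.d + ∑ᶠ i : ℕ, f.tau (-(i : ℤ)) ∘ₗ S.δ₁ ∘ₗ lpow S.v i = 0) ∧
  (f.lam ∘ₗ S.δ₂ + T.d ∘ₗ f.del2 - ∑ᶠ i : ℕ, lpow T.v i ∘ₗ T.δ₂ ∘ₗ f.tau (-(i : ℤ)) = 0) ∧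
  (f.mu ∘ₗ S.d + T.d ∘ₗ f.mu + f.lam ∘ₗ S.v - T.v ∘ₗ f.lam + f.del2 ∘ₗ S.δ₁ - T.δ₂ ∘ₗ f.del1 = 0)

/-- Composition of generalized height morphisms (Definition 2.23 of the paper). -/
noncomputable def HMor.compH {S T U : SCData R} (g : HMor T U) (f : HMor S T) : HMor S U where
  lam := g.lam ∘ₗ f.lam
    + (∑ᶠ i : ℕ, ∑ j ∈ Finset.range (i + 1),
        lpow U.v j ∘ₗ U.δ₂ ∘ₗ g.tau (-((i : ℤ) + 1)) ∘ₗ f.del1 ∘ₗ lpow S.v (i - j))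
    + (∑ᶠ i : ℕ, ∑ j ∈ Finset.range (i + 1),
        lpow U.v j ∘ₗ g.del2 ∘ₗ f.tau (-((i : ℤ) + 1)) ∘ₗ S.δ₁ ∘ₗ lpow S.v (i - j))
    + (∑ᶠ i : ℕ, ∑ j ∈ Finset.range (i + 1), ∑ l ∈ Finset.range (i - j + 1),
        lpow U.v j ∘ₗ U.δ₂ ∘ₗ g.tau (-((i : ℤ) + 2)) ∘ₗ T.δ₁ ∘ₗ lpow T.v l ∘ₗ f.mu ∘ₗ
          lpow S.v (i - j - l))
    + (∑ᶠ i : ℕ, ∑ j ∈ Finset.range (i + 1), ∑ l ∈ Finset.range (i - j + 1),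
        lpow U.v j ∘ₗ g.mu ∘ₗ lpow T.v l ∘ₗ T.δ₂ ∘ₗ f.tau (-((i : ℤ) + 2)) ∘ₗ S.δ₁ ∘ₗ
          lpow S.v (i - j - l))
  mu := g.lam ∘ₗ f.mu + g.mu ∘ₗ f.lam + g.del2 ∘ₗ f.del1
  del1 := g.del1 ∘ₗ f.lam + (∑ᶠ i : ℕ, g.tau (-(i : ℤ)) ∘ₗ f.del1 ∘ₗ lpow S.v i)
    + (∑ᶠ i : ℕ, ∑ j ∈ Finset.range (i + 1),
        g.tau (-((i : ℤ) + 1)) ∘ₗ T.δ₁ ∘ₗ lpow T.v j ∘ₗ f.mu ∘ₗ lpow S.v (i - j))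
  del2 := g.lam ∘ₗ f.del2 + (∑ᶠ i : ℕ, lpow U.v i ∘ₗ g.del2 ∘ₗ f.tau (-(i : ℤ)))
    + (∑ᶠ i : ℕ, ∑ j ∈ Finset.range (i + 1),
        lpow U.v j ∘ₗ g.mu ∘ₗ lpow T.v (i - j) ∘ₗ T.δ₂ ∘ₗ f.tau (-((i : ℤ) + 1)))
  tau := fun i => ∑ᶠ l : ℤ, g.tau (i - l) ∘ₗ f.tau l

/-- The strong height `−n` morphism `κ~_n : Σ^n C~ → C~`. -/
def kappaN (T : SCData R) (n : ℕ) : HMor (T.suspN n) T where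
  lam := LinearMap.fst R T.Irr.carrier (Fin n → T.Red.carrier)
  mu := 0
  del1 := 0
  del2 := 0
  tau := fun i => if i = -(n : ℤ) then LinearMap.id else 0

/-- An (even degree) morphism of `S`-complexes, regarded as a generalized height morphism. -/
def SMap.toHMor {S T : SCData R} (f : SMap S T) : HMor S T where
  lam := f.lam
  mu := f.mu
  del1 := f.del1
  del2 := f.del2
  tau := fun i => if 0 ≤ i then tauSMap f i.toNat else 0

/-- The height `0` morphism `λ~' : C~ → Σ^n C~'` associated to a height `−n` morphism
(Proposition 2.25 of the paper). -/
def heightNegToSusp {S T : SCData R} (f : HMor S T) (n : ℕ) : SMap S (T.suspN n) where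
  lam := LinearMap.prod f.lam
    (LinearMap.pi fun m : Fin n =>
      ∑ i ∈ Finset.Icc ((m : ℕ) + 1) n, f.tau (-(i : ℤ)) ∘ₗ S.δ₁ ∘ₗ lpow S.v (i - 1 - (m : ℕ)))
  mu := LinearMap.prod f.mu (LinearMap.pi fun m : Fin n => if (m : ℕ) = 0 then f.del1 else 0)
  del1 := 0
  del2 := LinearMap.prod f.del2 (LinearMap.pi fun m : Fin n => f.tau (-((m : ℕ) : ℤ)))
  rho := f.tau (-(n : ℤ))

/-- The morphism `ι~₁ : C~ → ΣC~`. -/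
def iotaOne (S : SCData R) : SMap S S.susp where
  lam := LinearMap.prod LinearMap.id 0
  mu := 0
  del1 := 0
  del2 := LinearMap.prod 0 LinearMap.id
  rho := 0

/-- The morphism `λ~'' : ΣC~' → C~''` associated to an odd degree morphism `λ~'` together
with the map `ν' : 𝖱' → 𝖱''` (Subsection 2.6 of the paper). -/
def lambdaSecond {S T : SCData R} (f : SMap S T) (nu : S.Red.carrier →ₗ[R] T.Red.carrier) :
    SMap S.susp T where
  lam := f.lam ∘ₗ LinearMap.fst R S.Irr.carrier S.Red.carrier +
    f.del2 ∘ₗ LinearMap.snd R S.Irr.carrier S.Red.carrier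
  mu := f.mu ∘ₗ LinearMap.fst R S.Irr.carrier S.Red.carrier
  del1 := f.del1 ∘ₗ LinearMap.fst R S.Irr.carrier S.Red.carrier +
    nu ∘ₗ LinearMap.snd R S.Irr.carrier S.Red.carrier
  del2 := f.mu ∘ₗ S.δ₂ + T.v ∘ₗ f.del2 + T.δ₂ ∘ₗ nu
  rho := 0

/-- The morphism `λ~₁ : C~ → ΣC~'` associated to height `−1` morphism data
`(λ, μ, Δ₁, Δ₂, τ₀, τ₋₁)`, in block form
`[[λ, 0, 0], [τ₋₁δ₁, 0, 0], [μ, λ, Δ₂], [Δ₁, τ₋₁δ₁, τ₀], [0, 0, τ₋₁]]`. -/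
def hNegOneSusp {S T : SCData R} (lam0 mu0 : S.Irr.carrier →ₗ[R] T.Irr.carrier)
    (del10 : S.Irr.carrier →ₗ[R] T.Red.carrier) (del20 : S.Red.carrier →ₗ[R] T.Irr.carrier)
    (tau0 taum1 : S.Red.carrier →ₗ[R] T.Red.carrier) : SMap S T.susp where
  lam := LinearMap.prod lam0 (taum1 ∘ₗ S.δ₁)
  mu := LinearMap.prod mu0 del10
  del1 := 0
  del2 := LinearMap.prod del20 tau0
  rho := taum1

/-- The mapping cone of a degree `k` morphism `λ~ : C~ → C~'`, as an `S`-complex;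
its underlying graded module is `C~[-1-k] ⊕ C~'`. -/
def coneSC {S T : SCData R} (f : SMap S T) (k : ℤ) : SCData R where
  Irr := { carrier := S.Irr.carrier × T.Irr.carrier
           grading := fun j => (S.Irr.grading (j - 1 - k)).prod (T.Irr.grading j) }
  Red := { carrier := S.Red.carrier × T.Red.carrier
           grading := fun j => (S.Red.grading (j - 1 - k)).prod (T.Red.grading j) }
  d := LinearMap.prod (-(S.d ∘ₗ LinearMap.fst R S.Irr.carrier T.Irr.carrier))
      (f.lam ∘ₗ LinearMap.fst R S.Irr.carrier T.Irr.carrier +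
        T.d ∘ₗ LinearMap.snd R S.Irr.carrier T.Irr.carrier)
  v := LinearMap.prod (S.v ∘ₗ LinearMap.fst R S.Irr.carrier T.Irr.carrier)
      (f.mu ∘ₗ LinearMap.fst R S.Irr.carrier T.Irr.carrier +
        T.v ∘ₗ LinearMap.snd R S.Irr.carrier T.Irr.carrier)
  δ₁ := LinearMap.prod (-(S.δ₁ ∘ₗ LinearMap.fst R S.Irr.carrier T.Irr.carrier))
      (f.del1 ∘ₗ LinearMap.fst R S.Irr.carrier T.Irr.carrier +
        T.δ₁ ∘ₗ LinearMap.snd R S.Irr.carrier T.Irr.carrier)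
  δ₂ := LinearMap.prod (S.δ₂ ∘ₗ LinearMap.fst R S.Red.carrier T.Red.carrier)
      (f.del2 ∘ₗ LinearMap.fst R S.Red.carrier T.Red.carrier +
        T.δ₂ ∘ₗ LinearMap.snd R S.Red.carrier T.Red.carrier)
  r := LinearMap.prod (-(S.r ∘ₗ LinearMap.fst R S.Red.carrier T.Red.carrier))
      (f.rho ∘ₗ LinearMap.fst R S.Red.carrier T.Red.carrier +
        T.r ∘ₗ LinearMap.snd R S.Red.carrier T.Red.carrier)

/-- Direct sum of `S`-complexes. -/
def sumSC (S T : SCData R) : SCData R where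
  Irr := S.Irr.prodGM T.Irr
  Red := S.Red.prodGM T.Red
  d := S.d.prodMap T.d
  v := S.v.prodMap T.v
  δ₁ := S.δ₁.prodMap T.δ₁
  δ₂ := S.δ₂.prodMap T.δ₂
  r := S.r.prodMap T.r

/-- The dual `S`-complex `C~†`, defined using sign operators on the dual graded modules:
`m†(f) = −ε(f) f ∘ m`, with the roles of `δ₁` and `δ₂` interchanged. -/
def dualSC (S : SCData R)
    (eCd : Module.Dual R S.Irr.carrier →ₗ[R] Module.Dual R S.Irr.carrier)
    (eRd : Module.Dual R S.Red.carrier →ₗ[R] Module.Dual R S.Red.carrier) : SCData R where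
  Irr := S.Irr.dualGM
  Red := S.Red.dualGM
  d := -(S.d.dualMap ∘ₗ eCd)
  v := -(S.v.dualMap ∘ₗ eCd)
  δ₁ := -(S.δ₂.dualMap ∘ₗ eCd)
  δ₂ := -(S.δ₁.dualMap ∘ₗ eRd)
  r := -(S.r.dualMap ∘ₗ eRd)

/-- The rank-one graded module `R`, concentrated in degree `n`. -/
def unitGM (R : Type u) [CommRing R] (n : ℤ) : GradedMod R where
  carrier := R
  grading j := if j = n then ⊤ else ⊥

/-- The `S`-complex `O~(1)`: `C = R` in degree `1`, `𝖱 = R` in degree `0`, `δ₁ = id`. -/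
def O1 (R : Type u) [CommRing R] : SCData R where
  Irr := unitGM R 1
  Red := unitGM R 0
  d := 0
  v := 0
  δ₁ := LinearMap.id
  δ₂ := 0
  r := 0

/-- The `S`-complex `O~(-1)`: `C = R` in degree `-2`, `𝖱 = R` in degree `0`, `δ₂ = id`. -/
def Om1 (R : Type u) [CommRing R] : SCData R where
  Irr := unitGM R (-2)
  Red := unitGM R 0
  d := 0
  v := 0
  δ₁ := 0
  δ₂ := LinearMap.id
  r := 0

/-- The `S`-complex `O~(0)`: `C = 0`, `𝖱 = R` in degree `0`, zero differential. -/
def O0 (R : Type u) [CommRing R] : SCData R where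
  Irr := { carrier := ↥(⊥ : Submodule R R), grading := fun _ => ⊥ }
  Red := unitGM R 0
  d := 0
  v := 0
  δ₁ := 0
  δ₂ := 0
  r := 0

/-- The `S`-complex representation of the tensor product `C~ ⊗ C~'` of `S`-complexes
(Subsection 2.2 of the paper), where `eC`, `eR` are the sign operators of the first factor:
`C^⊗ = (C⊗C') ⊕ (C⊗C')[-1] ⊕ (C⊗𝖱') ⊕ (𝖱⊗C')` and `𝖱^⊗ = 𝖱⊗𝖱'`. -/
noncomputable def tensorRep (S T : SCData R)
    (eC : S.Irr.carrier →ₗ[R] S.Irr.carrier) (eR : S.Red.carrier →ₗ[R] S.Red.carrier) :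
    SCData R where
  Irr := (S.Irr.tensorGM T.Irr).prodGM (((S.Irr.tensorGM T.Irr).shift (-1)).prodGM
      ((S.Irr.tensorGM T.Red).prodGM (S.Red.tensorGM T.Irr)))
  Red := S.Red.tensorGM T.Red
  d := quad
      (TensorProduct.map S.d LinearMap.id ∘ₗ qj₁ + TensorProduct.map eC T.d ∘ₗ qj₁)
      (TensorProduct.map (-(eC ∘ₗ S.v)) LinearMap.id ∘ₗ qj₁ + TensorProduct.map eC T.v ∘ₗ qj₁
        + TensorProduct.map S.d LinearMap.id ∘ₗ qj₂ - TensorProduct.map eC T.d ∘ₗ qj₂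
        + TensorProduct.map eC T.δ₂ ∘ₗ qj₃
        + TensorProduct.map (-(eC ∘ₗ S.δ₂)) LinearMap.id ∘ₗ qj₄)
      (TensorProduct.map eC T.δ₁ ∘ₗ qj₁ + TensorProduct.map S.d LinearMap.id ∘ₗ qj₃
        + TensorProduct.map eC T.r ∘ₗ qj₃)
      (TensorProduct.map S.δ₁ LinearMap.id ∘ₗ qj₁ + TensorProduct.map eR T.d ∘ₗ qj₄
        + TensorProduct.map S.r LinearMap.id ∘ₗ qj₄)
  v := quad
      (TensorProduct.map S.v LinearMap.id ∘ₗ qj₁ + TensorProduct.map S.δ₂ LinearMap.id ∘ₗ qj₄)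
      (TensorProduct.map S.v LinearMap.id ∘ₗ qj₂)
      (TensorProduct.map S.v LinearMap.id ∘ₗ qj₃)
      (TensorProduct.map (eR ∘ₗ S.δ₁) LinearMap.id ∘ₗ qj₂ + TensorProduct.map LinearMap.id T.v ∘ₗ qj₄)
  δ₁ := TensorProduct.map S.δ₁ LinearMap.id ∘ₗ qj₃ + TensorProduct.map eR T.δ₁ ∘ₗ qj₄
  δ₂ := quad 0 0 (TensorProduct.map S.δ₂ LinearMap.id) (TensorProduct.map LinearMap.id T.δ₂)
  r := TensorProduct.map S.r LinearMap.id + TensorProduct.map eR T.r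

/-- Homology of an endomorphism (thought of as a differential): `ker D / im D`. -/
abbrev homologyOf {M : Type u} [AddCommGroup M] [Module R M] (D : M →ₗ[R] M) : Type u :=
  ↥(LinearMap.ker D) ⧸
    Submodule.comap (LinearMap.ker D).subtype (LinearMap.range D)

/-- The map induced on homology by a chain map. -/
def inducedMap {M N : Type u} [AddCommGroup M] [Module R M] [AddCommGroup N] [Module R N]
    (DM : M →ₗ[R] M) (DN : N →ₗ[R] N) (f : M →ₗ[R] N) (h : DN ∘ₗ f = f ∘ₗ DM) :
    homologyOf DM →ₗ[R] homologyOf DN :=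
  Submodule.mapQ _ _
    (f.restrict (p := LinearMap.ker DM) (q := LinearMap.ker DN) (fun x hx => by
      have h1 : DN (f x) = f (DM x) := by
        have h2 := LinearMap.congr_fun h x
        simpa using h2
      have hx0 : DM x = 0 := LinearMap.mem_ker.mp hx
      simp [LinearMap.mem_ker, h1, hx0]))
    (by
      intro x hx
      simp only [Submodule.mem_comap] at hx ⊢
      obtain ⟨y, hy⟩ := hx
      refine ⟨f y, ?_⟩
      have h1 : DN (f y) = f (DM y) := by
        have h2 := LinearMap.congr_fun h y
        simpa using h2
      simp only [Submodule.coe_subtype] at hy ⊢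
      rw [LinearMap.restrict_apply]
      rw [h1, hy])

/-- The degree `j` homology of a graded module with a (degree `-1`) differential. -/
abbrev gradedHomology (M : GradedMod R) (D : M.carrier →ₗ[R] M.carrier) (j : ℤ) : Type u :=
  ↥(M.grading j ⊓ LinearMap.ker D) ⧸
    Submodule.comap (M.grading j ⊓ LinearMap.ker D).subtype ((M.grading (j + 1)).map D)

/-- The Euler characteristic `Σ_j (-1)^j rk_R M_j` of a graded module. -/
noncomputable def eulerChar (M : GradedMod R) : ℤ :=
  ∑ᶠ j : ℤ, (if Even j then (1 : ℤ) else -1) * (Module.finrank R ↥(M.grading j) : ℤ)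

/-- The small equivariant complex `Ĉ = C[-1] ⊕ 𝖱[x]`, with `𝖱[x]` modelled as `ℕ →₀ 𝖱`. -/
abbrev hatC (S : SCData R) : Type u := S.Irr.carrier × (ℕ →₀ S.Red.carrier)

/-- The differential `𝔡̂(α, θxⁱ) = (dα − vⁱδ₂θ, 0)`. -/
noncomputable def hatD (S : SCData R) : hatC S →ₗ[R] hatC S :=
  LinearMap.prod
    (S.d ∘ₗ LinearMap.fst R S.Irr.carrier (ℕ →₀ S.Red.carrier) -
      (Finsupp.lsum ℕ fun i : ℕ => lpow S.v i ∘ₗ S.δ₂) ∘ₗ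
        LinearMap.snd R S.Irr.carrier (ℕ →₀ S.Red.carrier))
    0

/-- The `x`-action `x·(α, θxⁱ) = (vα, δ₁α + θx^{i+1})` on `Ĉ`. -/
noncomputable def hatX (S : SCData R) : hatC S →ₗ[R] hatC S :=
  LinearMap.prod (S.v ∘ₗ LinearMap.fst R S.Irr.carrier (ℕ →₀ S.Red.carrier))
    (Finsupp.lsingle 0 ∘ₗ S.δ₁ ∘ₗ LinearMap.fst R S.Irr.carrier (ℕ →₀ S.Red.carrier) +
      Finsupp.lmapDomain S.Red.carrier R (fun i => i + 1) ∘ₗ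
        LinearMap.snd R S.Irr.carrier (ℕ →₀ S.Red.carrier))

/-- The small equivariant complex `Č = C ⊕ 𝖱[[x⁻¹,x]/𝖱[x]`, the tail modelled as `ℕ → 𝖱`
(the `m`-th coordinate is the coefficient of `x^{-m-1}`). -/
abbrev checkC (S : SCData R) : Type u := S.Irr.carrier × (ℕ → S.Red.carrier)

/-- The differential `𝔡̌(α, θxⁱ) = (dα, Σ_{j≤-1} δ₁v^{−j−1}(α)xʲ)`. -/
noncomputable def checkD (S : SCData R) : checkC S →ₗ[R] checkC S :=
  LinearMap.prod (S.d ∘ₗ LinearMap.fst R S.Irr.carrier (ℕ → S.Red.carrier))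
    (LinearMap.pi fun m : ℕ =>
      S.δ₁ ∘ₗ lpow S.v m ∘ₗ LinearMap.fst R S.Irr.carrier (ℕ → S.Red.carrier))

/-- The `x`-action on `Č`. -/
noncomputable def checkX (S : SCData R) : checkC S →ₗ[R] checkC S :=
  LinearMap.prod
    (S.v ∘ₗ LinearMap.fst R S.Irr.carrier (ℕ → S.Red.carrier) +
      S.δ₂ ∘ₗ LinearMap.proj 0 ∘ₗ LinearMap.snd R S.Irr.carrier (ℕ → S.Red.carrier))
    (LinearMap.pi fun m : ℕ =>
      LinearMap.proj (m + 1) ∘ₗ LinearMap.snd R S.Irr.carrier (ℕ → S.Red.carrier))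

/-- The module `𝖱[[x⁻¹,x]` of Laurent series with finitely many positive powers, modelled
as (polynomial part, tail): `(ℕ →₀ 𝖱) × (ℕ → 𝖱)`. -/
abbrev barC (S : SCData R) : Type u := (ℕ →₀ S.Red.carrier) × (ℕ → S.Red.carrier)

/-- Multiplication by `x` on `𝖱[[x⁻¹,x]`. -/
noncomputable def barX (S : SCData R) : barC S →ₗ[R] barC S :=
  LinearMap.prod
    (Finsupp.lsingle 0 ∘ₗ LinearMap.proj 0 ∘ₗ
        LinearMap.snd R (ℕ →₀ S.Red.carrier) (ℕ → S.Red.carrier) +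
      Finsupp.lmapDomain S.Red.carrier R (fun i => i + 1) ∘ₗ
        LinearMap.fst R (ℕ →₀ S.Red.carrier) (ℕ → S.Red.carrier))
    (LinearMap.pi fun m : ℕ =>
      LinearMap.proj (m + 1) ∘ₗ LinearMap.snd R (ℕ →₀ S.Red.carrier) (ℕ → S.Red.carrier))

/-- The chain map `𝔦 : Ĉ → 𝖱[[x⁻¹,x]`, `(α, θ) ↦ Σ_{i≤-1} δ₁v^{−i−1}(α)xⁱ + θ`. -/
noncomputable def mapI (S : SCData R) : hatC S →ₗ[R] barC S :=
  LinearMap.prod (LinearMap.snd R S.Irr.carrier (ℕ →₀ S.Red.carrier))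
    (LinearMap.pi fun m : ℕ =>
      S.δ₁ ∘ₗ lpow S.v m ∘ₗ LinearMap.fst R S.Irr.carrier (ℕ →₀ S.Red.carrier))

/-- The chain map `𝔧 : Č → Ĉ`, `(α, ·) ↦ (−α, 0)`. -/
noncomputable def mapJ (S : SCData R) : checkC S →ₗ[R] hatC S :=
  LinearMap.prod (-(LinearMap.fst R S.Irr.carrier (ℕ → S.Red.carrier))) 0

/-- The chain map `𝔭 : 𝖱[[x⁻¹,x] → Č`, `Σθᵢxⁱ ↦ (Σ_{i≥0} vⁱδ₂θᵢ, Σ_{i≤-1} θᵢxⁱ)`. -/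
noncomputable def mapP (S : SCData R) : barC S →ₗ[R] checkC S :=
  LinearMap.prod
    ((Finsupp.lsum ℕ fun i : ℕ => lpow S.v i ∘ₗ S.δ₂) ∘ₗ
      LinearMap.fst R (ℕ →₀ S.Red.carrier) (ℕ → S.Red.carrier))
    (LinearMap.snd R (ℕ →₀ S.Red.carrier) (ℕ → S.Red.carrier))

/-- The coefficient of `xᵉ`, as a linear map `𝖱[[x⁻¹,x] → 𝖱`. -/
noncomputable def coeffLM (S : SCData R) (e : ℤ) : barC S →ₗ[R] S.Red.carrier :=
  if 0 ≤ e then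
    Finsupp.lapply e.toNat ∘ₗ LinearMap.fst R (ℕ →₀ S.Red.carrier) (ℕ → S.Red.carrier)
  else
    LinearMap.proj (-e - 1).toNat ∘ₗ LinearMap.snd R (ℕ →₀ S.Red.carrier) (ℕ → S.Red.carrier)

/-- `𝔍(C~) ⊆ 𝖱[[x⁻¹,x]`, the image of `i⋆ : Ĥ → 𝖱[[x⁻¹,x]` (equal to `𝔦(ker 𝔡̂)`). -/
noncomputable def Jmod (S : SCData R) : Submodule R (barC S) :=
  (LinearMap.ker (hatD S)).map (mapI S)

/-- `J_i(C~) = { a₀ ∈ 𝖱 | ∃ a₀x^{-i} + a₋₁x^{-i-1} + ⋯ ∈ 𝔍(C~) }`. -/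
noncomputable def Jset (S : SCData R) (i : ℤ) : Submodule R S.Red.carrier :=
  ((Jmod S) ⊓ ⨅ (e : ℤ) (_ : -i < e), LinearMap.ker (coeffLM S e)).map (coeffLM S (-i))

/-- The function `d_{C~}(i) = rk_R J_i(C~)`. -/
noncomputable def dFun (S : SCData R) (i : ℤ) : ℕ := Module.finrank R ↥(Jset S i)

namespace GradedMod

variable {M N P : GradedMod R} {k l m : ℤ}

lemma IsDeg.apply_mem {f : M.carrier →ₗ[R] N.carrier} (hf : M.IsDeg N k f) (h : l + k = m)
    {x : M.carrier} (hx : x ∈ M.grading l) : f x ∈ N.grading m :=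
  h ▸ hf l (Submodule.mem_map_of_mem hx)

lemma IsDeg.zero : M.IsDeg N k 0 := by
  rintro i _ ⟨x, -, rfl⟩
  simp

lemma IsDeg.add {f g : M.carrier →ₗ[R] N.carrier} (hf : M.IsDeg N k f) (hg : M.IsDeg N k g) :
    M.IsDeg N k (f + g) := by
  rintro i _ ⟨x, hx, rfl⟩
  exact add_mem (hf.apply_mem rfl hx) (hg.apply_mem rfl hx)

lemma IsDeg.neg {f : M.carrier →ₗ[R] N.carrier} (hf : M.IsDeg N k f) : M.IsDeg N k (-f) := by
  rintro i _ ⟨x, hx, rfl⟩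
  exact neg_mem (hf.apply_mem rfl hx)

lemma IsDeg.sub {f g : M.carrier →ₗ[R] N.carrier} (hf : M.IsDeg N k f) (hg : M.IsDeg N k g) :
    M.IsDeg N k (f - g) := by
  rw [sub_eq_add_neg]
  exact hf.add hg.neg

lemma IsDeg.comp {g : N.carrier →ₗ[R] P.carrier} {f : M.carrier →ₗ[R] N.carrier}
    (hg : N.IsDeg P k g) (hf : M.IsDeg N l f) (h : l + k = m) : M.IsDeg P m (g ∘ₗ f) := by
  rintro i _ ⟨x, hx, rfl⟩
  exact hg.apply_mem (by omega) (hf.apply_mem rfl hx)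

/-- A bijective degree `0` map between internally graded modules has a degree `0` inverse. -/
lemma IsDeg.symm (hM : DirectSum.IsInternal M.grading) (hN : DirectSum.IsInternal N.grading)
    {e : M.carrier ≃ₗ[R] N.carrier} (he : M.IsDeg N 0 (e : M.carrier →ₗ[R] N.carrier)) :
    N.IsDeg M 0 (e.symm : N.carrier →ₗ[R] M.carrier) := by
  let _ := hM.chooseDecomposition
  let _ := hN.chooseDecomposition
  have he' : ∀ {i x}, x ∈ M.grading i → e x ∈ N.grading i := fun hx =>
    he.apply_mem (add_zero _) hx
  have comm : ∀ (x : M.carrier) (j : ℤ),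
      (DirectSum.decompose N.grading (e x) j : N.carrier) =
        e (DirectSum.decompose M.grading x j) := by
    intro x j
    induction x using DirectSum.Decomposition.inductionOn M.grading with
    | zero => simp
    | @homogeneous i x =>
      by_cases h : i = j
      · subst h
        rw [DirectSum.decompose_of_mem_same _ (he' x.2), DirectSum.decompose_of_mem_same _ x.2]
      · rw [DirectSum.decompose_of_mem_ne _ (he' x.2) h, DirectSum.decompose_of_mem_ne _ x.2 h,
          map_zero]
    | add x y hx hy => simp [DirectSum.decompose_add, hx, hy]
  rintro i _ ⟨y, hy, rfl⟩
  have h := comm (e.symm y) i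
  rw [e.apply_symm_apply, DirectSum.decompose_of_mem_same _ hy] at h
  rw [add_zero, LinearEquiv.coe_coe, h, e.symm_apply_apply]
  exact SetLike.coe_mem _

end GradedMod

section Total

variable {S T : SCData R}

lemma SCData.totalDiff_apply (x y : S.Irr.carrier) (z : S.Red.carrier) :
    S.totalDiff (x, y, z) = (S.d x, S.v x - S.d y + S.δ₂ z, S.δ₁ x + S.r z) := rfl

lemma morTotal_apply (f : SMap S T) (x y : S.Irr.carrier) (z : S.Red.carrier) :
    morTotal f (x, y, z) =
      (f.lam x, f.mu x + f.lam y + f.del2 z, f.del1 x + f.rho z) := rfl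

lemma htpTotal_apply (K : SMap S T) (x y : S.Irr.carrier) (z : S.Red.carrier) :
    htpTotal K (x, y, z) =
      (K.lam x, K.mu x - K.lam y + K.del2 z, K.del1 x + K.rho z) := rfl

lemma SCData.totalDiff_totalDiff (h : S.Relations) (w : S.Tot.carrier) :
    S.totalDiff (S.totalDiff w) = 0 := by
  obtain ⟨x, y, z⟩ := w
  obtain ⟨h₁, h₂, h₃, h₄, h₅⟩ := h
  have e₁ := LinearMap.congr_fun h₁
  have e₂ := LinearMap.congr_fun h₂ x
  have e₃ := LinearMap.congr_fun h₃ z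
  have e₄ := LinearMap.congr_fun h₄ x
  have e₅ := LinearMap.congr_fun h₅ z
  simp only [LinearMap.comp_apply, LinearMap.add_apply, LinearMap.sub_apply,
    LinearMap.zero_apply] at e₁ e₂ e₃ e₄ e₅
  rw [totalDiff_apply, totalDiff_apply]
  refine Prod.ext (e₁ x) (Prod.ext ?_ ?_)
  · change S.v (S.d x) - S.d (S.v x - S.d y + S.δ₂ z) + S.δ₂ (S.δ₁ x + S.r z) = 0
    simp only [map_add, map_sub, e₁]
    linear_combination (norm := module) -e₄ - e₃
  · change S.δ₁ (S.d x) + S.r (S.δ₁ x + S.r z) = 0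
    rw [map_add, e₅, add_zero, e₂]

/-- The component relations of a morphism say that its total map is a chain map. -/
lemma SMap.isMor_iff_totalDiff_morTotal (f : SMap S T) :
    f.IsMor ↔ ∀ w, T.totalDiff (morTotal f w) = morTotal f (S.totalDiff w) := by
  constructor
  · rintro ⟨h₁, h₂, h₃, h₄, h₅⟩ ⟨x, y, z⟩
    have e₁ := LinearMap.congr_fun h₁
    have e₂ := LinearMap.congr_fun h₂ x
    have e₃ := LinearMap.congr_fun h₃ z
    have e₄ := LinearMap.congr_fun h₄ x
    have e₅ := LinearMap.congr_fun h₅ z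
    simp only [LinearMap.comp_apply, LinearMap.add_apply, LinearMap.sub_apply,
      LinearMap.zero_apply] at e₁ e₂ e₃ e₄ e₅
    rw [SCData.totalDiff_apply, morTotal_apply, morTotal_apply, SCData.totalDiff_apply]
    refine Prod.ext (sub_eq_zero.mp (e₁ x)) (Prod.ext ?_ ?_)
    · simp only [map_add, map_sub]
      linear_combination (norm := module) -e₄ - e₃ - e₁ y
    · simp only [map_add]
      linear_combination (norm := module) -e₂ - e₅
  · intro h
    have hx := fun x : S.Irr.carrier => h (x, 0, 0)
    have hz := fun z : S.Red.carrier => h (0, 0, z)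
    simp only [SCData.totalDiff_apply, morTotal_apply, map_zero, add_zero, zero_add, sub_zero,
      zero_sub] at hx hz
    replace hx := fun x => Prod.mk_inj.mp (hx x)
    replace hz := fun z => Prod.mk_inj.mp (hz z)
    simp only [Prod.mk.injEq, true_and] at hx hz
    refine ⟨?_, ?_, ?_, ?_, ?_⟩ <;> ext w <;>
      simp only [LinearMap.comp_apply, LinearMap.add_apply, LinearMap.sub_apply,
        LinearMap.zero_apply]
    · exact sub_eq_zero.mpr (hx w).1
    · linear_combination (norm := module) -(hx w).2.2
    · linear_combination (norm := module) -(hz w).1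
    · linear_combination (norm := module) -(hx w).2.1
    · linear_combination (norm := module) -(hz w).2

lemma morTotal_comp {U : SCData R} (g : SMap T U) (f : SMap S T) (w : S.Tot.carrier) :
    morTotal (g.comp f) w = morTotal g (morTotal f w) := by
  obtain ⟨x, y, z⟩ := w
  simp only [morTotal_apply, SMap.comp, LinearMap.comp_apply, LinearMap.add_apply, map_add]
  refine Prod.ext rfl (Prod.ext ?_ ?_) <;> dsimp only <;> abel

lemma morTotal_idMap (w : S.Tot.carrier) : morTotal (idMap S) w = w := by
  obtain ⟨x, y, z⟩ := w
  rw [morTotal_apply]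
  simp only [idMap, LinearMap.id_apply, LinearMap.zero_apply, zero_add, add_zero]
  rfl

end Total

namespace SMap

variable {S T : SCData R}

/-- The map obtained from `f` by subtracting the boundary `d~' K~ + K~ d~`. -/
def subBoundary (f K : SMap S T) : SMap S T where
  lam := f.lam - (T.d ∘ₗ K.lam + K.lam ∘ₗ S.d)
  mu := f.mu - (T.v ∘ₗ K.lam - T.d ∘ₗ K.mu + T.δ₂ ∘ₗ K.del1 + K.mu ∘ₗ S.d - K.lam ∘ₗ S.v
    + K.del2 ∘ₗ S.δ₁)
  del1 := f.del1 - (T.δ₁ ∘ₗ K.lam + T.r ∘ₗ K.del1 + K.del1 ∘ₗ S.d + K.rho ∘ₗ S.δ₁)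
  del2 := f.del2 - (-(T.d ∘ₗ K.del2) + T.δ₂ ∘ₗ K.rho - K.lam ∘ₗ S.δ₂ + K.del2 ∘ₗ S.r)
  rho := f.rho - (T.r ∘ₗ K.rho + K.rho ∘ₗ S.r)

lemma isHtpyFrom_subBoundary (f K : SMap S T) : IsHtpyFrom K f (f.subBoundary K) := by
  refine ⟨?_, ?_, ?_, ?_, ?_⟩ <;> simp only [subBoundary] <;> abel

lemma morTotal_subBoundary (f K : SMap S T) (w : S.Tot.carrier) :
    morTotal (f.subBoundary K) w =
      morTotal f w - (T.totalDiff (htpTotal K w) + htpTotal K (S.totalDiff w)) := by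
  obtain ⟨x, y, z⟩ := w
  simp only [morTotal_apply, htpTotal_apply, SCData.totalDiff_apply, subBoundary,
    LinearMap.comp_apply, LinearMap.add_apply, LinearMap.sub_apply, LinearMap.neg_apply,
    map_add, map_sub]
  refine Prod.ext rfl (Prod.ext ?_ ?_)
  · change _ = f.mu x + f.lam y + f.del2 z - (_ + _)
    dsimp only
    abel
  · change _ = f.del1 x + f.rho z - (_ + _)
    dsimp only
    abel

lemma IsMor.subBoundary {f : SMap S T} (hf : f.IsMor) (hS : S.Relations) (hT : T.Relations)
    (K : SMap S T) : (f.subBoundary K).IsMor := by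
  rw [isMor_iff_totalDiff_morTotal] at hf ⊢
  intro w
  simp only [morTotal_subBoundary, map_sub, map_add, hf, SCData.totalDiff_totalDiff hS,
    SCData.totalDiff_totalDiff hT, map_zero, zero_add, add_zero]

lemma DegreesAt.subBoundary {f K : SMap S T} (hf : f.DegreesAt 0) (hK : K.DegreesAt 1)
    (hS : S.Degrees) (hT : T.Degrees) : (f.subBoundary K).DegreesAt 0 := by
  obtain ⟨f₁, f₂, f₃, f₄, f₅⟩ := hf
  obtain ⟨k₁, k₂, k₃, k₄, k₅⟩ := hK
  obtain ⟨s₁, s₂, s₃, s₄, s₅⟩ := hS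
  obtain ⟨t₁, t₂, t₃, t₄, t₅⟩ := hT
  refine ⟨f₁.sub ((t₁.comp k₁ ?_).add (k₁.comp s₁ ?_)),
    f₂.sub ((((((t₂.comp k₁ ?_).sub (t₁.comp k₂ ?_)).add (t₄.comp k₃ ?_)).add
      (k₂.comp s₁ ?_)).sub (k₁.comp s₂ ?_)).add (k₄.comp s₃ ?_)),
    f₃.sub ((((t₃.comp k₁ ?_).add (t₅.comp k₃ ?_)).add (k₃.comp s₁ ?_)).add (k₅.comp s₃ ?_)),
    f₄.sub ((((t₁.comp k₄ ?_).neg.add (t₄.comp k₅ ?_)).sub (k₁.comp s₄ ?_)).add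
      (k₄.comp s₅ ?_)),
    f₅.sub ((t₅.comp k₅ ?_).add (k₅.comp s₅ ?_))⟩ <;> norm_num

/-- The inverse of a map in block form whose diagonal components have inverses `a` and `b`. -/
def blockInv (g : SMap S T) (a : T.Irr.carrier →ₗ[R] S.Irr.carrier)
    (b : T.Red.carrier →ₗ[R] S.Red.carrier) : SMap T S where
  lam := a
  mu := a ∘ₗ g.del2 ∘ₗ b ∘ₗ g.del1 ∘ₗ a - a ∘ₗ g.mu ∘ₗ a
  del1 := -(b ∘ₗ g.del1 ∘ₗ a)
  del2 := -(a ∘ₗ g.del2 ∘ₗ b)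
  rho := b

variable {g : SMap S T} {a : T.Irr.carrier →ₗ[R] S.Irr.carrier}
  {b : T.Red.carrier →ₗ[R] S.Red.carrier}

lemma blockInv_comp (ha : ∀ x, a (g.lam x) = x) (hb : ∀ z, b (g.rho z) = z) :
    (g.blockInv a b).comp g = idMap S := by
  simp only [comp, blockInv, idMap, SMap.mk.injEq]
  refine ⟨?_, ?_, ?_, ?_, ?_⟩ <;> ext w <;> simp [ha, hb]

lemma comp_blockInv (ha : ∀ x, g.lam (a x) = x) (hb : ∀ z, g.rho (b z) = z) :
    g.comp (g.blockInv a b) = idMap T := by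
  simp only [comp, blockInv, idMap, SMap.mk.injEq]
  refine ⟨?_, ?_, ?_, ?_, ?_⟩ <;> ext w <;> simp [ha, hb]

lemma DegreesAt.blockInv (hg : g.DegreesAt 0) (ha : T.Irr.IsDeg S.Irr 0 a)
    (hb : T.Red.IsDeg S.Red 0 b) : (g.blockInv a b).DegreesAt 0 := by
  obtain ⟨-, g₂, g₃, g₄, -⟩ := hg
  have h₃ := (hb.comp (g₃.comp ha (add_zero _)) (add_zero _))
  exact ⟨ha, (ha.comp (g₄.comp h₃ (zero_add _)) (add_zero _)).sub
      (ha.comp (g₂.comp ha (zero_add _)) (add_zero _)),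
    h₃.neg, (ha.comp (g₄.comp hb (zero_add _)) (add_zero _)).neg, hb⟩

lemma bijective_morTotal {g' : SMap T S} (h : g'.comp g = idMap S) (h' : g.comp g' = idMap T) :
    Function.Bijective (morTotal g) :=
  Function.bijective_iff_has_inverse.mpr ⟨morTotal g',
    fun w => by rw [← morTotal_comp, h, morTotal_idMap],
    fun w => by rw [← morTotal_comp, h', morTotal_idMap]⟩

lemma IsMor.of_comp_eq_idMap {g' : SMap T S} (hg : g.IsMor) (h : g'.comp g = idMap S)
    (h' : g.comp g' = idMap T) : g'.IsMor := by
  rw [isMor_iff_totalDiff_morTotal] at hg ⊢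
  intro w
  apply (bijective_morTotal h h').injective
  rw [← hg, ← morTotal_comp, ← morTotal_comp, h', morTotal_idMap, morTotal_idMap]

end SMap

/-- If the irreducible and reducible components of a morphism of
`S`-complexes are each chain homotopic to isomorphisms, then the morphism is `S`-chain
homotopic to an isomorphism of `S`-complexes. -/
theorem mor_htpy_iso {R : Type u} [CommRing R] {S T : SCData R}
    (hS : S.IsSComplex) (hT : T.IsSComplex)
    (f : SMap S T) (hf : f.IsMor) (hfd : f.DegreesAt 0)
    (hlam : ∃ K : S.Irr.carrier →ₗ[R] T.Irr.carrier, S.Irr.IsDeg T.Irr 1 K ∧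
      Function.Bijective ⇑(f.lam - (T.d ∘ₗ K + K ∘ₗ S.d)))
    (hrho : ∃ J : S.Red.carrier →ₗ[R] T.Red.carrier, S.Red.IsDeg T.Red 1 J ∧
      Function.Bijective ⇑(f.rho - (T.r ∘ₗ J + J ∘ₗ S.r))) :
    ∃ (g H : SMap S T), g.IsMor ∧ g.DegreesAt 0 ∧ H.DegreesAt 1 ∧ SMap.IsHtpyFrom H f g ∧
      Function.Bijective ⇑(morTotal g) ∧
      ∃ g' : SMap T S, g'.IsMor ∧ g'.DegreesAt 0 ∧ g'.comp g = idMap S ∧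
        g.comp g' = idMap T := by
  obtain ⟨K, hK, hKbij⟩ := hlam
  obtain ⟨J, hJ, hJbij⟩ := hrho
  obtain ⟨⟨hSI, -⟩, ⟨hSR, -⟩, hSd, hSr⟩ := hS
  obtain ⟨⟨hTI, -⟩, ⟨hTR, -⟩, hTd, hTr⟩ := hT
  let H : SMap S T := ⟨K, 0, 0, 0, J⟩
  have hH : H.DegreesAt 1 := ⟨hK, .zero, .zero, .zero, hJ⟩
  have hgd := hfd.subBoundary hH hSd hTd
  have hg := hf.subBoundary hSr hTr H
  let a := LinearEquiv.ofBijective (f.subBoundary H).lam hKbij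
  let b := LinearEquiv.ofBijective (f.subBoundary H).rho hJbij
  have h := SMap.blockInv_comp (g := f.subBoundary H) (a := a.symm) (b := b.symm)
    a.symm_apply_apply b.symm_apply_apply
  have h' := SMap.comp_blockInv (g := f.subBoundary H) (a := a.symm) (b := b.symm)
    a.apply_symm_apply b.apply_symm_apply
  exact ⟨_, H, hg, hgd, hH, f.isHtpyFrom_subBoundary H, SMap.bijective_morTotal h h', _,
    hg.of_comp_eq_idMap h h',
    hgd.blockInv (GradedMod.IsDeg.symm (e := a) hSI hTI hgd.1)
      (GradedMod.IsDeg.symm (e := b) hSR hTR hgd.2.2.2.2), h, h'⟩
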